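/- Identify ℝ⁸ with ℂ³ × ℝ² via x = (z₀, z₁, z₂, x₇, x₈) with z₀, z₁, z₂ ∈ ℂ. The Cartan cubic in dimension 8, f₂(x) = x₈³ − 3x₈x₇² + (3/2)x₈(|z₀|² + |z₁|² − 2|z₂|²) + (3√3/2)x₇(|z₀|² − |z₁|²) + (3√3/2)·(z₀z₁z₂ + conj(z₂)conj(z₁)conj(z₀)), satisfies both the eiconal equation |∇f₂(x)|² = 9|x|⁴ for all x ∈ ℝ⁸ and the Laplace equation Δf₂ = 0. -/

import Mathlib

/-- The Cartan isoparametric cubic in dimension 8 (corresponding to `ℂ`, `d = 2`),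
under the identification `ℝ⁸ ≅ ℂ³ × ℝ²`, `x = (z₀, z₁, z₂, x₇, x₈)` with
`z_k = (x_{2k+1}, x_{2k+2})`:
`f₂ = x₈³ − 3x₈x₇² + (3/2)x₈(|z₀|² + |z₁|² − 2|z₂|²) + (3√3/2)x₇(|z₀|² − |z₁|²)
  + (3√3/2)(z₀z₁z₂ + conj z₂ · conj z₁ · conj z₀)`. -/
noncomputable def cartanCubic8 : (Fin 8 → ℝ) → ℝ := fun x =>
  let z : Fin 3 → ℂ := fun k => ⟨x ⟨2 * k.1, by omega⟩, x ⟨2 * k.1 + 1, by omega⟩⟩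
  x 7 ^ 3 - 3 * x 7 * x 6 ^ 2 +
    3 / 2 * x 7 *
      (Complex.normSq (z 0) + Complex.normSq (z 1) - 2 * Complex.normSq (z 2)) +
    3 * Real.sqrt 3 / 2 * x 6 * (Complex.normSq (z 0) - Complex.normSq (z 1)) +
    3 * Real.sqrt 3 / 2 *
      (z 0 * z 1 * z 2 +
        (starRingEnd ℂ) (z 2) * (starRingEnd ℂ) (z 1) * (starRingEnd ℂ) (z 0)).re

/-- The directional derivative is the linear coefficient of a cubic expansion along the line. -/
lemma fderiv_apply_eq_of_cubic_expansion {E : Type*} [NormedAddCommGroup E] [NormedSpace ℝ E]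
    {f : E → ℝ} {x v : E} {a b c : ℝ} (hf : DifferentiableAt ℝ f x)
    (h : ∀ t : ℝ, f (x + t • v) = f x + t * a + t ^ 2 * b + t ^ 3 * c) :
    fderiv ℝ f x v = a := by
  rw [← hf.lineDeriv_eq_fderiv, lineDeriv, funext h]
  have h0 := (((((hasDerivAt_id (0 : ℝ)).mul_const a).const_add (f x)).add
    (((hasDerivAt_id (0 : ℝ)).pow 2).mul_const b)).add
    (((hasDerivAt_id (0 : ℝ)).pow 3).mul_const c))
  have h1 := h0.deriv
  simp only [id] at h1
  refine Eq.trans ?_ (h1.trans (by simp))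
  rfl

lemma cartanCubic8_apply (x : Fin 8 → ℝ) :
    cartanCubic8 x = x 7 ^ 3 - 3 * x 7 * x 6 ^ 2 +
      3 / 2 * x 7 * (x 0 ^ 2 + x 1 ^ 2 + x 2 ^ 2 + x 3 ^ 2 - 2 * x 4 ^ 2 - 2 * x 5 ^ 2) +
      3 * √3 / 2 * x 6 * (x 0 ^ 2 + x 1 ^ 2 - x 2 ^ 2 - x 3 ^ 2) +
      3 * √3 * (x 0 * x 2 * x 4 - x 0 * x 3 * x 5 - x 1 * x 2 * x 5 - x 1 * x 3 * x 4) := by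
  simp [cartanCubic8, Complex.normSq_apply]
  ring

lemma differentiable_cartanCubic8 : Differentiable ℝ cartanCubic8 := by
  rw [funext cartanCubic8_apply]
  fun_prop

/-- The gradient of `cartanCubic8`. -/
noncomputable def cartanCubic8Grad (x : Fin 8 → ℝ) : Fin 8 → ℝ :=
  ![3 * x 7 * x 0 + 3 * √3 * x 6 * x 0 + 3 * √3 * (x 2 * x 4 - x 3 * x 5),
    3 * x 7 * x 1 + 3 * √3 * x 6 * x 1 - 3 * √3 * (x 2 * x 5 + x 3 * x 4),
    3 * x 7 * x 2 - 3 * √3 * x 6 * x 2 + 3 * √3 * (x 0 * x 4 - x 1 * x 5),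
    3 * x 7 * x 3 - 3 * √3 * x 6 * x 3 - 3 * √3 * (x 0 * x 5 + x 1 * x 4),
    -6 * x 7 * x 4 + 3 * √3 * (x 0 * x 2 - x 1 * x 3),
    -6 * x 7 * x 5 - 3 * √3 * (x 0 * x 3 + x 1 * x 2),
    -6 * x 7 * x 6 + 3 * √3 / 2 * (x 0 ^ 2 + x 1 ^ 2 - x 2 ^ 2 - x 3 ^ 2),
    3 * x 7 ^ 2 - 3 * x 6 ^ 2 +
      3 / 2 * (x 0 ^ 2 + x 1 ^ 2 + x 2 ^ 2 + x 3 ^ 2 - 2 * x 4 ^ 2 - 2 * x 5 ^ 2)]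

/-- The diagonal of the Hessian of `cartanCubic8`. -/
noncomputable def cartanCubic8HessDiag (x : Fin 8 → ℝ) : Fin 8 → ℝ :=
  ![3 * x 7 + 3 * √3 * x 6, 3 * x 7 + 3 * √3 * x 6, 3 * x 7 - 3 * √3 * x 6,
    3 * x 7 - 3 * √3 * x 6, -6 * x 7, -6 * x 7, -6 * x 7, 6 * x 7]

lemma fderiv_cartanCubic8_single (x : Fin 8 → ℝ) (i : Fin 8) :
    fderiv ℝ cartanCubic8 x (Pi.single i 1) = cartanCubic8Grad x i := by
  refine fderiv_apply_eq_of_cubic_expansion (b := cartanCubic8HessDiag x i / 2)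
    (c := if i = 7 then 1 else 0) (differentiable_cartanCubic8 x) fun t => ?_
  fin_cases i <;>
    simp [cartanCubic8_apply, cartanCubic8Grad, cartanCubic8HessDiag] <;> ring

lemma differentiable_cartanCubic8Grad (i : Fin 8) :
    Differentiable ℝ fun x => cartanCubic8Grad x i := by
  fin_cases i <;> simp [cartanCubic8Grad] <;> fun_prop

lemma fderiv_cartanCubic8Grad_single (x : Fin 8 → ℝ) (i : Fin 8) :
    fderiv ℝ (fun y => cartanCubic8Grad y i) x (Pi.single i 1) = cartanCubic8HessDiag x i := by
  refine fderiv_apply_eq_of_cubic_expansion (b := if i = 7 then 3 else 0) (c := 0)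
    (differentiable_cartanCubic8Grad i x) fun t => ?_
  fin_cases i <;>
    simp [cartanCubic8Grad, cartanCubic8HessDiag] <;> ring

/-- The Cartan cubic in dimension 8 satisfies both the eiconal equation
`|∇f₂|² = 9|x|⁴` and the Laplace equation `Δf₂ = 0`. -/
theorem cartanCubic8_isoparametric :
    (∀ x : Fin 8 → ℝ,
      ∑ i, (fderiv ℝ cartanCubic8 x (Pi.single i 1)) ^ 2 = 9 * (∑ i, x i ^ 2) ^ 2) ∧
    (∀ x : Fin 8 → ℝ,
      ∑ i, fderiv ℝ (fun y => fderiv ℝ cartanCubic8 y (Pi.single i 1)) x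
        (Pi.single i 1) = 0) := by
  refine ⟨fun x => ?_, fun x => ?_⟩
  · have hs : √(3 : ℝ) ^ 2 = 3 := Real.sq_sqrt (by norm_num)
    simp only [fderiv_cartanCubic8_single, Fin.sum_univ_eight]
    simp only [cartanCubic8Grad, Matrix.cons_val]
    ring_nf
    simp only [hs]
    ring
  · simp only [fderiv_cartanCubic8_single, fderiv_cartanCubic8Grad_single, Fin.sum_univ_eight]
    simp only [cartanCubic8HessDiag, Matrix.cons_val]
    ring
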